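/- If a pseudo-Boolean function f : B^n → ℝ is p-locally monotone, then f has p-permutable lattice derivatives. -/

import Mathlib

open Finset

/-- Discrete partial derivative: `Δ_k f (x) = f(x_k^1) - f(x_k^0)`. -/
def pderiv {ι : Type*} [DecidableEq ι] (f : (ι → Bool) → ℝ) (k : ι) (x : ι → Bool) : ℝ :=
  f (Function.update x k true) - f (Function.update x k false)

/-- Meet derivative: `∧_k f (x) = f(x_k^0) ⊓ f(x_k^1)`. -/
def meetD {ι : Type*} [DecidableEq ι] (f : (ι → Bool) → ℝ) (k : ι) (x : ι → Bool) : ℝ :=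
  min (f (Function.update x k false)) (f (Function.update x k true))

/-- Join derivative: `∨_k f (x) = f(x_k^0) ⊔ f(x_k^1)`. -/
def joinD {ι : Type*} [DecidableEq ι] (f : (ι → Bool) → ℝ) (k : ι) (x : ι → Bool) : ℝ :=
  max (f (Function.update x k false)) (f (Function.update x k true))

/-- `f` is `p`-locally monotone: no partial derivative changes sign on tuples differing
in fewer than `p` positions (other than the `k`-th one). -/
def LocallyMonotone {n : ℕ} (p : ℕ) (f : (Fin n → Bool) → ℝ) : Prop :=
  ∀ k : Fin n, ∀ x y : Fin n → Bool,
    (Finset.univ.filter (fun i => i ≠ k ∧ x i ≠ y i)).card < p →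
    0 ≤ pderiv f k x * pderiv f k y

/-- A lattice-derivative operator: `(true, k)` is `∨_k`, `(false, k)` is `∧_k`. -/
def latD {ι : Type*} [DecidableEq ι] (ok : Bool × ι) (f : (ι → Bool) → ℝ) : (ι → Bool) → ℝ :=
  if ok.1 then joinD f ok.2 else meetD f ok.2

/-- Composition `O_{k_1} ⋯ O_{k_p} f` of the operators listed in `l`. -/
def applyOps {ι : Type*} [DecidableEq ι] (l : List (Bool × ι)) (f : (ι → Bool) → ℝ) :
    (ι → Bool) → ℝ := l.foldr latD f

/-- `f` has `p`-permutable lattice derivatives. -/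
def Permutable {ι : Type*} [DecidableEq ι] (p : ℕ) (f : (ι → Bool) → ℝ) : Prop :=
  ∀ l l' : List (Bool × ι), l.length = p → (l.map Prod.snd).Nodup → l.Perm l' →
    applyOps l f = applyOps l' f

/-- `f` is monotone: each partial derivative is everywhere nonnegative or everywhere
nonpositive. -/
def IsMonotoneFn {ι : Type*} [DecidableEq ι] (f : (ι → Bool) → ℝ) : Prop :=
  ∀ k : ι, (∀ x, 0 ≤ pderiv f k x) ∨ (∀ x, pderiv f k x ≤ 0)

/-- The tuple `a_S^x`: `i`-th component `x i` if `i ∈ S`, and `a i` otherwise. -/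
def restrictTo {n : ℕ} (S : Finset (Fin n)) (a : Fin n → Bool) (x : {i // i ∈ S} → Bool) :
    Fin n → Bool := fun i => if h : i ∈ S then x ⟨i, h⟩ else a i

/-- `g` is an `S`-section of `f`. -/
def IsSection {n : ℕ} (S : Finset (Fin n)) (f : (Fin n → Bool) → ℝ)
    (g : ({i // i ∈ S} → Bool) → ℝ) : Prop :=
  ∃ a : Fin n → Bool, ∀ x, g x = f (restrictTo S a x)

/-- A Boolean function viewed as real-valued. -/
def toReal {n : ℕ} (f : (Fin n → Bool) → Bool) : (Fin n → Bool) → ℝ :=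
  fun x => if f x then 1 else 0

/-- If `p` directions are fixed, then on every subcube they span, a lattice derivative of a
`p`-locally monotone function in one of these directions is a substitution. -/
lemma LocallyMonotone.exists_latD_eq_update {n p : ℕ} {f : (Fin n → Bool) → ℝ}
    (h : LocallyMonotone p f) {S : Finset (Fin n)} (hS : S.card = p) (a : Fin n → Bool)
    (ok : Bool × Fin n) (hk : ok.2 ∈ S) :
    ∃ c : Bool, ∀ x : Fin n → Bool, (∀ i, i ∉ S → x i = a i) →
      latD ok f x = f (Function.update x ok.2 c) := by
  obtain ⟨o, k⟩ := ok
  have hprod : ∀ x y : Fin n → Bool, (∀ i, i ∉ S → x i = a i) → (∀ i, i ∉ S → y i = a i) →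
      0 ≤ pderiv f k x * pderiv f k y := by
    intro x y hx hy
    refine h k x y (hS ▸ Finset.card_lt_card ((Finset.ssubset_iff_of_subset ?_).2 ⟨k, hk, by simp⟩))
    intro i hi
    by_contra hiS
    exact (Finset.mem_filter.1 hi).2.2 ((hx i hiS).trans (hy i hiS).symm)
  have hsign : (∀ x : Fin n → Bool, (∀ i, i ∉ S → x i = a i) → 0 ≤ pderiv f k x) ∨
      ∀ x : Fin n → Bool, (∀ i, i ∉ S → x i = a i) → pderiv f k x ≤ 0 := by
    by_contra! hcon
    obtain ⟨⟨x, hx, hx0⟩, y, hy, hy0⟩ := hcon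
    exact absurd (hprod x y hx hy) (not_le.2 (mul_neg_of_neg_of_pos hx0 hy0))
  rcases hsign with hs | hs
  · refine ⟨o, fun x hx => ?_⟩
    have := sub_nonneg.1 (hs x hx)
    cases o <;> simp [latD, meetD, joinD, this]
  · refine ⟨!o, fun x hx => ?_⟩
    have := sub_nonpos.1 (hs x hx)
    cases o <;> simp [latD, meetD, joinD, this]

/-- The tuple obtained from `x` by the substitutions `x_k := c (o, k)` for `(o, k)` in `l`. -/
def substAll {ι : Type*} [DecidableEq ι] (c : Bool × ι → Bool) (l : List (Bool × ι))
    (x : ι → Bool) : ι → Bool :=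
  l.foldr (fun ok y => Function.update y ok.2 (c ok)) x

lemma substAll_update {ι : Type*} [DecidableEq ι] (c : Bool × ι → Bool) (l : List (Bool × ι))
    (x : ι → Bool) {k : ι} (hk : k ∉ l.map Prod.snd) (b : Bool) :
    substAll c l (Function.update x k b) = Function.update (substAll c l x) k b := by
  induction l with
  | nil => rfl
  | cons ok l ih =>
    rw [List.map_cons, List.mem_cons, not_or] at hk
    change Function.update (substAll c l _) _ _ =
      Function.update (Function.update (substAll c l x) _ _) _ _
    rw [ih hk.2, Function.update_comm hk.1]

lemma substAll_apply_of_notMem {ι : Type*} [DecidableEq ι] (c : Bool × ι → Bool)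
    (l : List (Bool × ι)) (x : ι → Bool) {i : ι} (hi : i ∉ l.map Prod.snd) :
    substAll c l x i = x i := by
  have := congrFun (substAll_update c l x hi (x i)) i
  rwa [Function.update_eq_self, Function.update_self] at this

lemma substAll_perm {ι : Type*} [DecidableEq ι] (c : Bool × ι → Bool) {l l' : List (Bool × ι)}
    (hl : (l.map Prod.snd).Nodup) (hp : l.Perm l') (x : ι → Bool) :
    substAll c l x = substAll c l' x := by
  refine hp.foldr_eq' (fun u hu v hv z => ?_) x
  rcases eq_or_ne u v with rfl | huv
  · rfl
  · exact Function.update_comm (fun e => huv (List.inj_on_of_nodup_map hl hu hv e)) _ _ _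

/-- If each operator in `l` acts on `f` as a substitution on the subcube of tuples agreeing with
`a` outside `S`, then their composition acts there as the simultaneous substitution. -/
lemma applyOps_eq_substAll {ι : Type*} [DecidableEq ι] {f : (ι → Bool) → ℝ} {S : Finset ι}
    {a : ι → Bool} {c : Bool × ι → Bool} {l : List (Bool × ι)} (hl : (l.map Prod.snd).Nodup)
    (hS : ∀ ok ∈ l, ok.2 ∈ S)
    (hc : ∀ ok ∈ l, ∀ x : ι → Bool, (∀ i, i ∉ S → x i = a i) →
      latD ok f x = f (Function.update x ok.2 (c ok)))
    (x : ι → Bool) (hx : ∀ i, i ∉ S → x i = a i) :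
    applyOps l f x = f (substAll c l x) := by
  induction l generalizing x with
  | nil => rfl
  | cons ok l ih =>
    rw [List.map_cons, List.nodup_cons] at hl
    have hkS := hS ok List.mem_cons_self
    have hS' : ∀ ok' ∈ l, ok'.2 ∈ S := fun ok' h' => hS ok' (List.mem_cons_of_mem _ h')
    have hstep : ∀ b, applyOps l f (Function.update x ok.2 b) =
        f (Function.update (substAll c l x) ok.2 b) := by
      intro b
      rw [ih hl.2 hS' (fun ok' h' => hc ok' (List.mem_cons_of_mem _ h')),
        substAll_update c l x hl.1]
      intro i hi
      rw [Function.update_of_ne (ne_of_mem_of_not_mem hkS hi).symm, hx i hi]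
    have hlat : latD ok (applyOps l f) x = latD ok f (substAll c l x) := by
      unfold latD
      split_ifs <;> simp only [joinD, meetD, hstep]
    refine hlat.trans (hc ok List.mem_cons_self _ fun i hi => ?_)
    rw [substAll_apply_of_notMem, hx i hi]
    intro hmem
    obtain ⟨ok', h', rfl⟩ := List.mem_map.1 hmem
    exact hi (hS' ok' h')

theorem stmt15 {n : ℕ} (p : ℕ) (hp : 1 ≤ p) (hpn : p ≤ n) (f : (Fin n → Bool) → ℝ)
    (h : LocallyMonotone p f) : Permutable p f := by
  intro l l' hlen hnd hperm
  funext a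
  have hcard : (l.map Prod.snd).toFinset.card = p := by
    rw [List.toFinset_card_of_nodup hnd, List.length_map, hlen]
  have hS : ∀ ok ∈ l, ok.2 ∈ (l.map Prod.snd).toFinset := fun ok hok =>
    List.mem_toFinset.2 (List.mem_map_of_mem hok)
  have hex : ∀ ok : Bool × Fin n, ∃ c : Bool, ok ∈ l → ∀ x : Fin n → Bool,
      (∀ i, i ∉ (l.map Prod.snd).toFinset → x i = a i) →
        latD ok f x = f (Function.update x ok.2 c) := by
    intro ok
    by_cases hok : ok ∈ l
    · obtain ⟨c, hc⟩ := h.exists_latD_eq_update hcard a ok (hS ok hok)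
      exact ⟨c, fun _ => hc⟩
    · exact ⟨true, fun h' => absurd h' hok⟩
  choose c hc using hex
  rw [applyOps_eq_substAll hnd hS hc a fun _ _ => rfl,
    applyOps_eq_substAll ((hperm.map Prod.snd).nodup_iff.1 hnd)
      (fun ok hok => hS ok (hperm.mem_iff.2 hok)) (fun ok hok => hc ok (hperm.mem_iff.2 hok)) a
      fun _ _ => rfl,
    substAll_perm c hnd hperm]
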